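/- arXiv:1212.2135 — 2 statements merged into one kernel-verified Lean document; each statement's English description precedes it below -/
import Mathlib

section
/- Let X ⊆ ℝⁿ be compact, let f : ℝⁿ → ℝ be continuous, and suppose x* ∈ X is the unique global minimizer of f on X. Assume moreover that for every ε > 0, the intersection of X with the open ball of radius ε around x* has positive Lebesgue measure. Then for every ε > 0, lim_{κ → ∞} ( ∫_{X ∩ B(x*,ε)} exp(−κ f(y)) dy ) / ( ∫_X exp(−κ f(y)) dy ) = 1; that is, the Boltzmann distribution concentrates all its mass near the minimizer as κ → ∞. -/
open MeasureTheory Filter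

/-- A continuous function whose unique minimizer on the compact set `X` is `a` stays uniformly above
its minimum on `X` outside any ball around `a`. -/
theorem IsCompact.exists_lt_forall_le_diff_ball {α : Type*} [PseudoMetricSpace α] {X : Set α}
    (hX : IsCompact X) {f : α → ℝ} (hf : ContinuousOn f X) {a : α}
    (hmin : ∀ y ∈ X, f a ≤ f y) (huniq : ∀ y ∈ X, f y = f a → y = a) {ε : ℝ} (hε : 0 < ε) :
    ∃ m, f a < m ∧ ∀ y ∈ X \ Metric.ball a ε, m ≤ f y := by
  rcases (X \ Metric.ball a ε).eq_empty_or_nonempty with h | h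
  · exact ⟨f a + 1, by linarith, by simp [h]⟩
  · obtain ⟨z, hz, hzmin⟩ := (hX.diff Metric.isOpen_ball).exists_isMinOn h
      (hf.mono Set.sdiff_subset)
    refine ⟨f z, lt_of_le_of_ne (hmin z hz.1) fun heq => hz.2 ?_, fun y hy => hzmin hy⟩
    rw [huniq z hz.1 heq.symm]
    exact Metric.mem_ball_self hε

/-- Pincus-type concentration: as `κ → ∞` the Boltzmann distribution on a
compact set `X` with continuous energy `f` concentrates all its mass near the
unique global minimizer `x*`. -/
theorem boltzmann_concentration {n : ℕ} (X : Set (Fin n → ℝ))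
    (hXc : IsCompact X) (f : (Fin n → ℝ) → ℝ) (hf : Continuous f)
    (xstar : Fin n → ℝ) (hxstar : xstar ∈ X)
    (hmin : ∀ y ∈ X, f xstar ≤ f y)
    (huniq : ∀ y ∈ X, f y = f xstar → y = xstar)
    (hball : ∀ ε > 0, 0 < volume (X ∩ Metric.ball xstar ε)) :
    ∀ ε > 0,
      Tendsto
        (fun κ : ℝ =>
          (∫ y in X ∩ Metric.ball xstar ε, Real.exp (-κ * f y)) /
            ∫ y in X, Real.exp (-κ * f y))
        atTop (nhds 1) := by
  intro ε hε
  obtain ⟨m, hm, hmK⟩ :=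
    hXc.exists_lt_forall_le_diff_ball hf.continuousOn hmin huniq hε
  obtain ⟨c, hc, hcm⟩ := exists_between hm
  obtain ⟨δ, hδ, hδc⟩ := Metric.eventually_nhds_iff_ball.1
    (hf.continuousAt.eventually (gt_mem_nhds hc))
  set B := X ∩ Metric.ball xstar δ
  set K := X \ Metric.ball xstar ε
  have hBmeas : MeasurableSet B := hXc.measurableSet.inter measurableSet_ball
  have hKmeas : MeasurableSet K := hXc.measurableSet.diff measurableSet_ball
  have hBtop : volume B ≠ ⊤ := measure_ne_top_of_subset Set.inter_subset_left hXc.measure_ne_top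
  have hKtop : volume K ≠ ⊤ := measure_ne_top_of_subset Set.sdiff_subset hXc.measure_ne_top
  have hBpos : 0 < volume.real B := ENNReal.toReal_pos (hball δ hδ).ne' hBtop
  have hint (κ : ℝ) : IntegrableOn (fun y => Real.exp (-κ * f y)) X :=
    Continuous.continuousOn (by fun_prop) |>.integrableOn_compact hXc
  have hlower (κ : ℝ) (hκ : 0 ≤ κ) :
      volume.real B * Real.exp (-κ * c) ≤ ∫ y in X, Real.exp (-κ * f y) := calc
    _ = ∫ _ in B, Real.exp (-κ * c) := by simp
    _ ≤ ∫ y in B, Real.exp (-κ * f y) := by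
      refine setIntegral_mono_on (integrableOn_const hBtop)
        ((hint κ).mono_set Set.inter_subset_left) hBmeas fun y hy => Real.exp_le_exp.2 ?_
      nlinarith [hδc y hy.2]
    _ ≤ _ := setIntegral_mono_set (hint κ) (.of_forall fun _ => (Real.exp_pos _).le)
      Set.inter_subset_left.eventuallyLE
  have hupper (κ : ℝ) (hκ : 0 ≤ κ) :
      ∫ y in K, Real.exp (-κ * f y) ≤ volume.real K * Real.exp (-κ * m) := calc
    _ ≤ ∫ _ in K, Real.exp (-κ * m) := by
      refine setIntegral_mono_on ((hint κ).mono_set Set.sdiff_subset)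
        (integrableOn_const hKtop) hKmeas fun y hy => Real.exp_le_exp.2 ?_
      nlinarith [hmK y hy]
    _ = _ := by simp
  have hpos (κ : ℝ) (hκ : 0 ≤ κ) : 0 < ∫ y in X, Real.exp (-κ * f y) :=
    (mul_pos hBpos (Real.exp_pos _)).trans_le (hlower κ hκ)
  have htail : Tendsto
      (fun κ : ℝ => (∫ y in K, Real.exp (-κ * f y)) / ∫ y in X, Real.exp (-κ * f y))
      atTop (nhds 0) := by
    have hbound : Tendsto
        (fun κ : ℝ => volume.real K / volume.real B * Real.exp (-((m - c) * κ)))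
        atTop (nhds 0) := by
      simpa using (Real.tendsto_exp_neg_atTop_nhds_zero.comp
        (tendsto_id.const_mul_atTop (sub_pos.2 hcm))).const_mul
          (volume.real K / volume.real B)
    refine squeeze_zero' (.of_forall fun κ => ?_) ?_ hbound
    · exact div_nonneg (integral_nonneg fun _ => (Real.exp_pos _).le)
        (integral_nonneg fun _ => (Real.exp_pos _).le)
    · filter_upwards [eventually_ge_atTop 0] with κ hκ
      calc
        _ ≤ volume.real K * Real.exp (-κ * m) / (volume.real B * Real.exp (-κ * c)) :=
          div_le_div₀ (by positivity) (hupper κ hκ) (by positivity) (hlower κ hκ)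
        _ = _ := by
          rw [mul_div_mul_comm, ← Real.exp_sub]
          ring_nf
  have hlim := htail.const_sub 1
  rw [sub_zero] at hlim
  refine hlim.congr' ?_
  filter_upwards [eventually_ge_atTop 0] with κ hκ
  rw [sub_eq_iff_eq_add, ← add_div, integral_inter_add_sdiff measurableSet_ball (hint κ),
    div_self (hpos κ hκ).ne']
end

section
/- Let X ⊆ ℝⁿ be compact, let f : ℝⁿ → ℝ be continuous, and suppose x* ∈ X is the unique global minimizer of f on X. Assume moreover that for every ε > 0, the intersection of X with the open ball of radius ε around x* has positive Lebesgue measure. Then the mean of the Boltzmann distribution converges to the minimizer: lim_{κ → ∞} ( ∫_X y · exp(−κ f(y)) dy ) / ( ∫_X exp(−κ f(y)) dy ) = x*. -/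
open MeasureTheory Filter

section Laplace

open Set Topology

variable {α : Type*} [TopologicalSpace α] [TopologicalSpace.MetrizableSpace α] [MeasurableSpace α]
  [BorelSpace α] {μ : Measure α} [IsLocallyFiniteMeasure μ] {s : Set α} {f : α → ℝ} {x₀ : α}

theorem integrableOn_exp_neg_mul_of_isCompact (hs : IsCompact s) (hf : Continuous f) (κ : ℝ) :
    IntegrableOn (fun x => Real.exp (-κ * f x)) s μ :=
  ContinuousOn.integrableOn_compact hs (by fun_prop)

/-- The partition function `∫ exp (-κ f)` is at least `μ (s ∩ {f < b}) * exp (-κ b)`. -/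
theorem measureReal_mul_exp_le_setIntegral_exp (hs : IsCompact s) (hf : Continuous f) (b : ℝ)
    {κ : ℝ} (hκ : 0 ≤ κ) :
    μ.real (s ∩ {x | f x < b}) * Real.exp (-κ * b) ≤ ∫ x in s, Real.exp (-κ * f x) ∂μ := by
  have hI := integrableOn_exp_neg_mul_of_isCompact (μ := μ) hs hf κ
  calc
    μ.real (s ∩ {x | f x < b}) * Real.exp (-κ * b)
        = ∫ _ in s ∩ {x | f x < b}, Real.exp (-κ * b) ∂μ := by simp
    _ ≤ ∫ x in s ∩ {x | f x < b}, Real.exp (-κ * f x) ∂μ := by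
      refine setIntegral_mono_on (integrableOn_const
        ((measure_mono inter_subset_left).trans_lt hs.measure_lt_top).ne)
        (hI.mono_set inter_subset_left)
        (hs.measurableSet.inter (isOpen_lt hf continuous_const).measurableSet) fun x hx => ?_
      have hx' : f x ≤ b := le_of_lt hx.2
      exact Real.exp_le_exp.2 (by nlinarith)
    _ ≤ ∫ x in s, Real.exp (-κ * f x) ∂μ :=
      setIntegral_mono_set hI (Eventually.of_forall fun x => (Real.exp_pos _).le)
        (Eventually.of_forall inter_subset_left)

/-- If a continuous function `f` attains its minimum over a compact set `s` only at `x₀`, and every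
neighborhood of `x₀` has positive measure in `s`, then the Boltzmann averages of `g` over `s`
converge to `g x₀`. -/
theorem tendsto_setIntegral_exp_smul_of_unique_minimum_of_isCompact
    {E : Type*} [NormedAddCommGroup E] [NormedSpace ℝ E] [CompleteSpace E] {g : α → E}
    (hs : IsCompact s) (hμ : ∀ u, IsOpen u → x₀ ∈ u → 0 < μ (s ∩ u)) (hf : Continuous f)
    (hmin : ∀ y ∈ s, y ≠ x₀ → f x₀ < f y)
    (hmg : IntegrableOn g s μ) (hcg : ContinuousWithinAt g s x₀) :
    Tendsto (fun κ : ℝ => (∫ x in s, Real.exp (-κ * f x) ∂μ)⁻¹ •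
      ∫ x in s, Real.exp (-κ * f x) • g x ∂μ) atTop (𝓝 (g x₀)) := by
  let Z : ℝ → ℝ := fun κ => ∫ x in s, Real.exp (-κ * f x) ∂μ
  let φ : ℝ → α → ℝ := fun κ x => (Z κ)⁻¹ * Real.exp (-κ * f x)
  have hφ_nonneg : ∀ κ x, 0 ≤ φ κ x := fun κ x =>
    mul_nonneg (inv_nonneg.2 (integral_nonneg fun _ => (Real.exp_pos _).le)) (Real.exp_pos _).le
  have hpos : ∀ b, f x₀ < b → 0 < μ.real (s ∩ {x | f x < b}) := fun b hb =>
    ENNReal.toReal_pos (hμ _ (isOpen_lt hf continuous_const) hb).ne'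
      ((measure_mono inter_subset_left).trans_lt hs.measure_lt_top).ne
  have hφ_integral : ∀ᶠ κ in atTop, ∫ x in s, φ κ x ∂μ = 1 := by
    filter_upwards [eventually_ge_atTop 0] with κ hκ
    have hZ : 0 < Z κ := (mul_pos (hpos (f x₀ + 1) (by linarith)) (Real.exp_pos _)).trans_le
      (measureReal_mul_exp_le_setIntegral_exp hs hf _ hκ)
    rw [integral_const_mul]
    exact inv_mul_cancel₀ hZ.ne'
  have hφ_unif : ∀ u : Set α, IsOpen u → x₀ ∈ u → TendstoUniformlyOn φ 0 atTop (s \ u) := by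
    intro u u_open x₀u
    obtain ⟨m, hm, hmf⟩ : ∃ m, f x₀ < m ∧ ∀ x ∈ s \ u, m ≤ f x := by
      rcases eq_empty_or_nonempty (s \ u) with h | h
      · exact ⟨f x₀ + 1, by linarith, by simp [h]⟩
      · obtain ⟨x, hx, hx'⟩ := (hs.diff u_open).exists_isMinOn h hf.continuousOn
        refine ⟨f x, hmin x hx.1 ?_, fun y hy => hx' hy⟩
        rintro rfl
        exact hx.2 x₀u
    obtain ⟨b, hb, hbm⟩ := exists_between hm
    have hC := hpos b hb
    set C := μ.real (s ∩ {x | f x < b})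
    have hlim : Tendsto (fun κ : ℝ => C⁻¹ * Real.exp (-(κ * (m - b)))) atTop (𝓝 0) := by
      simpa using (Real.tendsto_exp_neg_atTop_nhds_zero.comp
        (tendsto_id.atTop_mul_const (sub_pos.2 hbm))).const_mul C⁻¹
    refine Metric.tendstoUniformlyOn_iff.2 fun ε hε => ?_
    filter_upwards [(tendsto_order.1 hlim).2 ε hε, eventually_ge_atTop 0] with κ hκε hκ x hx
    simp only [Pi.zero_apply, dist_zero_left, Real.norm_of_nonneg (hφ_nonneg κ x)]
    refine lt_of_le_of_lt ?_ hκε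
    calc
      φ κ x ≤ (C * Real.exp (-κ * b))⁻¹ * Real.exp (-κ * m) := by
        have hxm := hmf x hx
        refine mul_le_mul (inv_anti₀ (mul_pos hC (Real.exp_pos _))
          (measureReal_mul_exp_le_setIntegral_exp hs hf b hκ))
          (Real.exp_le_exp.2 (by nlinarith)) (Real.exp_pos _).le (by positivity)
      _ = C⁻¹ * Real.exp (-(κ * (m - b))) := by
        rw [mul_inv, ← Real.exp_neg, mul_assoc, ← Real.exp_add]
        ring_nf
  have key : Tendsto (fun κ => ∫ x in s, φ κ x • g x ∂μ) atTop (𝓝 (g x₀)) :=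
    tendsto_setIntegral_peak_smul_of_integrableOn_of_tendsto hs.measurableSet hs.measurableSet
      Subset.rfl self_mem_nhdsWithin hs.measure_lt_top.ne
      (Eventually.of_forall fun κ x _ => hφ_nonneg κ x) hφ_unif
      (tendsto_const_nhds.congr' (hφ_integral.mono fun _ h => h.symm))
      (Eventually.of_forall fun κ =>
        ((integrableOn_exp_neg_mul_of_isCompact hs hf κ).const_mul _).aestronglyMeasurable)
      hmg hcg
  simpa only [φ, Z, ← smul_smul, integral_smul] using key

end Laplace

/-- Pincus (1968): the mean of the Boltzmann distribution on a compact set `X`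
converges to the unique global minimizer `x*` as the energy level `κ → ∞`. -/
theorem boltzmann_mean_tendsto_minimizer {n : ℕ} (X : Set (Fin n → ℝ))
    (hXc : IsCompact X) (f : (Fin n → ℝ) → ℝ) (hf : Continuous f)
    (xstar : Fin n → ℝ) (hxstar : xstar ∈ X)
    (hmin : ∀ y ∈ X, f xstar ≤ f y)
    (huniq : ∀ y ∈ X, f y = f xstar → y = xstar)
    (hball : ∀ ε > 0, 0 < volume (X ∩ Metric.ball xstar ε)) :
    Tendsto
      (fun κ : ℝ =>
        (∫ y in X, Real.exp (-κ * f y)) ⁻¹ • ∫ y in X, Real.exp (-κ * f y) • y)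
      atTop (nhds xstar) := by
  refine tendsto_setIntegral_exp_smul_of_unique_minimum_of_isCompact (g := fun y => y) hXc
    (fun u hu hxu => ?_) hf
    (fun y hy hne => (hmin y hy).lt_of_ne fun h => hne (huniq y hy h.symm))
    (continuous_id.continuousOn.integrableOn_compact hXc) continuous_id.continuousWithinAt
  obtain ⟨ε, hε, hεu⟩ := Metric.isOpen_iff.1 hu xstar hxu
  exact (hball ε hε).trans_le (measure_mono (Set.inter_subset_inter_right X hεu))
end
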